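/- arXiv:1106.5176 — 2 statements merged into one kernel-verified Lean document; each statement's English description precedes it below -/
import Mathlib

section
/- Let R₂ = 𝔽₂[X,Y]/(Y² + X·Y + X⁵ + X³ + X² + X). Then the ideal class group ClassGroup(R₂) is a finite group of cardinality 10. -/
noncomputable section

open Polynomial

/-- The polynomial `Y² + X·Y + (X⁵ + X³ + X² + X)` as an element of `𝔽₂[X][Y]`
(the outer variable is `Y`, the inner variable is `X`). -/
def f2 : Polynomial (Polynomial (ZMod 2)) :=
  X ^ 2 + C X * X + C (X ^ 5 + X ^ 3 + X ^ 2 + X)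

/-- The ring `R₂ = 𝔽₂[X,Y]/(Y² + X·Y + X⁵ + X³ + X² + X)`. -/
def R2 : Type := Polynomial (Polynomial (ZMod 2)) ⧸ Ideal.span {f2}

instance : CommRing R2 := Ideal.Quotient.commRing _

/-- The quotient map `𝔽₂[X][Y] → R₂`. -/
def toR2 : Polynomial (Polynomial (ZMod 2)) →+* R2 :=
  Ideal.Quotient.mk (Ideal.span {f2})

/-- The image `x` of `X` in `R₂`. -/
def x2 : R2 := toR2 (C X)

/-- The image `y` of `Y` in `R₂`. -/
def y2 : R2 := toR2 X

/-- The polynomial `f = X⁵ + X³ + X² + X` of the equation `y² + x y + f(x) = 0`. -/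
def curvePoly : (ZMod 2)[X] := X ^ 5 + X ^ 3 + X ^ 2 + X

/-- The embedding of `𝔽₂[X]` into `R₂`. -/
def polyToR2 : (ZMod 2)[X] →+* R2 := toR2.comp C

/-- The norm form: `normForm a b` is the norm of `a + b y`. -/
def normForm (a b : (ZMod 2)[X]) : (ZMod 2)[X] := a ^ 2 - a * X * b + b ^ 2 * curvePoly

/-- The ideal with Mumford representation `(u, y + v)`. -/
def mumford (u v : (ZMod 2)[X]) : Ideal R2 := Ideal.span {polyToR2 u, y2 + polyToR2 v}

lemma y2_sq : y2 ^ 2 = -(polyToR2 X * y2) - polyToR2 curvePoly := by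
  have h : toR2 f2 = 0 := Ideal.Quotient.eq_zero_iff_mem.mpr (Ideal.subset_span rfl)
  rw [f2, map_add, map_add, map_mul, map_pow] at h
  change y2 ^ 2 + polyToR2 X * y2 + polyToR2 curvePoly = 0 at h
  linear_combination h

lemma natDegree_curvePoly : curvePoly.natDegree = 5 := by
  unfold curvePoly; compute_degree!

lemma curvePoly_ne_zero : curvePoly ≠ 0 := fun h => by
  simpa [h] using natDegree_curvePoly

lemma f2_eq : f2 = X ^ 2 + (C X * X + C curvePoly) := by
  rw [f2, curvePoly, add_assoc]

lemma degree_f2_tail : (C X * X + C curvePoly : (ZMod 2)[X][X]).degree < (2 : ℕ) :=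
  degree_linear_lt

lemma f2_monic : f2.Monic := by
  rw [f2_eq]
  exact monic_X_pow_add degree_f2_tail

lemma degree_f2 : f2.degree = 2 := by
  rw [f2_eq, degree_add_eq_left_of_degree_lt] <;> rw [degree_X_pow]
  · rfl
  · exact degree_f2_tail

lemma exists_repr (r : R2) : ∃ a b, r = polyToR2 a + polyToR2 b * y2 := by
  obtain ⟨p, rfl⟩ := Ideal.Quotient.mk_surjective r
  change ∃ a b, toR2 p = _
  have hd : (p %ₘ f2).degree ≤ 1 := by
    have := degree_modByMonic_lt p f2_monic
    rw [degree_f2] at this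
    exact Order.le_of_lt_succ this
  have h0 : toR2 f2 = 0 := Ideal.Quotient.eq_zero_iff_mem.mpr (Ideal.subset_span rfl)
  refine ⟨(p %ₘ f2).coeff 0, (p %ₘ f2).coeff 1, ?_⟩
  conv_lhs => rw [← modByMonic_add_div p f2, map_add, map_mul, h0, zero_mul, add_zero,
    eq_X_add_C_of_degree_le_one hd, map_add, map_mul, add_comm]
  rfl

lemma repr_eq_zero {a b : (ZMod 2)[X]} (h : polyToR2 a + polyToR2 b * y2 = 0) :
    a = 0 ∧ b = 0 := by
  have h' : toR2 (C b * X + C a) = 0 := by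
    rw [map_add, map_mul, add_comm]; exact h
  have hd : f2 ∣ C b * X + C a :=
    Ideal.mem_span_singleton.mp (Ideal.Quotient.eq_zero_iff_mem.mp h')
  have h0 : C b * X + C a = 0 := by
    refine eq_zero_of_dvd_of_degree_lt hd ?_
    rw [degree_f2]
    exact degree_linear_lt
  constructor
  · simpa using congrArg (coeff · 0) h0
  · simpa using congrArg (coeff · 1) h0

lemma repr_inj {a b c d : (ZMod 2)[X]}
    (h : polyToR2 a + polyToR2 b * y2 = polyToR2 c + polyToR2 d * y2) : a = c ∧ b = d := by
  have := repr_eq_zero (a := a - c) (b := b - d) (by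
    rw [map_sub, map_sub]; linear_combination h)
  exact ⟨sub_eq_zero.mp this.1, sub_eq_zero.mp this.2⟩

lemma polyToR2_injective : Function.Injective polyToR2 := fun a b h =>
  (repr_inj (a := a) (b := 0) (c := b) (d := 0) (by rw [h])).1

lemma polyToR2_ne_zero {a : (ZMod 2)[X]} (h : a ≠ 0) : polyToR2 a ≠ 0 := by
  rwa [Ne, map_eq_zero_iff _ polyToR2_injective]

lemma repr_mul (a b c d : (ZMod 2)[X]) :
    (polyToR2 a + polyToR2 b * y2) * (polyToR2 c + polyToR2 d * y2) =
      polyToR2 (a * c - b * d * curvePoly) +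
        polyToR2 (a * d + b * c - b * d * X) * y2 := by
  simp only [map_add, map_sub, map_mul]
  linear_combination polyToR2 b * polyToR2 d * y2_sq

lemma normForm_mul (a b c d : (ZMod 2)[X]) :
    normForm (a * c - b * d * curvePoly) (a * d + b * c - b * d * X) =
      normForm a b * normForm c d := by
  unfold normForm; ring

lemma mul_conj (a b : (ZMod 2)[X]) :
    (polyToR2 a + polyToR2 b * y2) * (polyToR2 (a - b * X) + polyToR2 (-b) * y2) =
      polyToR2 (normForm a b) := by
  rw [repr_mul, show a * -b + b * (a - b * X) - b * -b * X = 0 by ring, map_zero, zero_mul,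
    add_zero, normForm]
  congr 1; ring

lemma five_le_natDegree_normForm (a : (ZMod 2)[X]) {b : (ZMod 2)[X]} (hb : b ≠ 0) :
    5 ≤ (normForm a b).natDegree := by
  have h2 : (b ^ 2 * curvePoly).natDegree = 2 * b.natDegree + 5 := by
    rw [natDegree_mul (pow_ne_zero 2 hb) curvePoly_ne_zero, natDegree_pow, natDegree_curvePoly]
  have h1 : (a * X * b).natDegree ≤ a.natDegree + 1 + b.natDegree :=
    natDegree_mul_le_of_le (natDegree_mul_le_of_le le_rfl natDegree_X_le) le_rfl
  have h0 : (a ^ 2).natDegree = 2 * a.natDegree := natDegree_pow a 2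
  rcases le_or_gt a.natDegree (b.natDegree + 2) with h | h
  · have h3 := natDegree_sub_le (a ^ 2) (a * X * b)
    rw [normForm, natDegree_add_eq_right_of_natDegree_lt] <;> omega
  · have h3 := natDegree_sub_le (b ^ 2 * curvePoly) (a * X * b)
    rw [normForm, sub_add_comm, sub_add_eq_add_sub, add_comm, add_sub_assoc,
      natDegree_add_eq_left_of_natDegree_lt] <;> omega

lemma normForm_ne_zero {a b : (ZMod 2)[X]} (h : polyToR2 a + polyToR2 b * y2 ≠ 0) :
    normForm a b ≠ 0 := by
  by_cases hb : b = 0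
  · subst hb
    have ha : a ≠ 0 := by rintro rfl; simp at h
    simpa [normForm] using ha
  · intro h0
    simpa [h0] using five_le_natDegree_normForm a hb

lemma mem_mumford_left (u v : (ZMod 2)[X]) : polyToR2 u ∈ mumford u v :=
  Ideal.subset_span (by simp)

lemma mem_mumford_right (u v : (ZMod 2)[X]) : y2 + polyToR2 v ∈ mumford u v :=
  Ideal.subset_span (by simp)

lemma mumford_le {u v : (ZMod 2)[X]} {I : Ideal R2} (h₁ : polyToR2 u ∈ I)
    (h₂ : y2 + polyToR2 v ∈ I) : mumford u v ≤ I := by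
  rw [mumford, Ideal.span_le]
  rintro z (rfl | rfl) <;> assumption

lemma dvd_of_mem_mumford {u v a b : (ZMod 2)[X]} (huv : u ∣ normForm v 1)
    (h : polyToR2 a + polyToR2 b * y2 ∈ mumford u v) : u ∣ a - b * v := by
  obtain ⟨s, t, hst⟩ := Ideal.mem_span_pair.mp h
  obtain ⟨s₀, s₁, rfl⟩ := exists_repr s
  obtain ⟨t₀, t₁, rfl⟩ := exists_repr t
  obtain ⟨w, hw⟩ := huv
  have := repr_inj (a := a) (b := b) (c := u * s₀ + t₀ * v - t₁ * curvePoly)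
    (d := u * s₁ + t₀ + t₁ * v - t₁ * X) (by
      rw [← hst]; simp only [map_add, map_sub, map_mul]
      linear_combination polyToR2 t₁ * y2_sq)
  rw [this.1, this.2]
  refine ⟨s₀ - s₁ * v - t₁ * w, ?_⟩
  unfold normForm at hw
  linear_combination (-t₁) * hw

lemma two_eq_zero_R2 : (2 : R2) = 0 := by
  have := congrArg polyToR2 (CharTwo.two_eq_zero (R := (ZMod 2)[X]))
  rwa [map_ofNat, map_zero] at this

/-- The conjugate of `y + v` is `y + v + X`, since the characteristic is `2`. -/
lemma y2_add_mul_conj (v : (ZMod 2)[X]) :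
    (y2 + polyToR2 v) * (y2 + polyToR2 (v + X)) = polyToR2 (normForm v 1) := by
  simp only [normForm, map_add, map_sub, map_mul, map_pow, map_one]
  linear_combination y2_sq +
    (y2 * polyToR2 v + polyToR2 v * polyToR2 X - polyToR2 curvePoly) * two_eq_zero_R2

lemma y2_add_ne_zero (v : (ZMod 2)[X]) : y2 + polyToR2 v ≠ 0 := fun h =>
  one_ne_zero (repr_eq_zero (a := v) (b := 1) (by rw [map_one]; linear_combination h)).2

lemma mumford_mul {u₁ u₂ v : (ZMod 2)[X]} (h : u₁ * u₂ ∣ normForm v 1) {r s t : (ZMod 2)[X]}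
    (hrst : r * u₁ + s * u₂ + t * X = 1) :
    mumford u₁ v * mumford u₂ v = mumford (u₁ * u₂) v := by
  apply le_antisymm
  · rw [mumford, mumford, Ideal.span_pair_mul_span_pair, Ideal.span_le]
    have h₁ := mem_mumford_left (u₁ * u₂) v
    have h₂ := mem_mumford_right (u₁ * u₂) v
    rintro z (rfl | rfl | rfl | rfl)
    · rwa [← map_mul]
    all_goals first | exact Ideal.mul_mem_left _ _ h₂ | exact Ideal.mul_mem_right _ _ h₂
  · have m₁ := mem_mumford_left u₁ v
    have m₂ := mem_mumford_left u₂ v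
    have n₁ := mem_mumford_right u₁ v
    have n₂ := mem_mumford_right u₂ v
    apply mumford_le
    · rw [map_mul]
      exact Ideal.mul_mem_mul m₁ m₂
    · have hN := y2_add_mul_conj v
      obtain ⟨w, hw⟩ := h
      have hr := congrArg polyToR2 hrst
      simp only [hw, map_add, map_mul, map_one] at hN hr
      have key : y2 + polyToR2 v =
          polyToR2 r * (polyToR2 u₁ * (y2 + polyToR2 v)) +
          polyToR2 s * ((y2 + polyToR2 v) * polyToR2 u₂) +
          polyToR2 (t * w) * (polyToR2 u₁ * polyToR2 u₂) -
          polyToR2 t * ((y2 + polyToR2 v) * (y2 + polyToR2 v)) := by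
        rw [map_mul]
        linear_combination -(y2 + polyToR2 v) * hr + polyToR2 t * hN
      rw [key]
      exact sub_mem (add_mem (add_mem (Ideal.mul_mem_left _ _ (Ideal.mul_mem_mul m₁ n₂))
        (Ideal.mul_mem_left _ _ (Ideal.mul_mem_mul n₁ m₂)))
        (Ideal.mul_mem_left _ _ (Ideal.mul_mem_mul m₁ m₂)))
        (Ideal.mul_mem_left _ _ (Ideal.mul_mem_mul n₁ n₂))

lemma mumford_mul_conj {u w v : (ZMod 2)[X]} (h : normForm v 1 = u * w) {r s t : (ZMod 2)[X]}
    (hrst : r * u + s * X + t * w = 1) :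
    mumford u v * mumford u (v + X) = Ideal.span {polyToR2 u} := by
  have hN := y2_add_mul_conj v
  apply le_antisymm
  · rw [mumford, mumford, Ideal.span_pair_mul_span_pair, Ideal.span_le]
    have hu := Ideal.mem_span_singleton_self (polyToR2 u)
    rintro z (rfl | rfl | rfl | rfl)
    · exact Ideal.mul_mem_right _ _ hu
    · exact Ideal.mul_mem_right _ _ hu
    · exact Ideal.mul_mem_left _ _ hu
    · rw [hN, h, map_mul]
      exact Ideal.mul_mem_right _ _ hu
  · have m₁ := mem_mumford_left u v
    have m₂ := mem_mumford_left u (v + X)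
    have n₁ := mem_mumford_right u v
    have n₂ := mem_mumford_right u (v + X)
    rw [Ideal.span_singleton_le_iff_mem]
    have hr := congrArg polyToR2 hrst
    simp only [map_add, map_mul, map_one] at hr
    have key : polyToR2 u = polyToR2 r * (polyToR2 u * polyToR2 u) +
        polyToR2 s * (polyToR2 u * (y2 + polyToR2 (v + X)) - (y2 + polyToR2 v) * polyToR2 u) +
        polyToR2 t * ((y2 + polyToR2 v) * (y2 + polyToR2 (v + X))) := by
      rw [hN, h, map_add, map_mul]
      linear_combination -polyToR2 u * hr
    rw [key]
    exact add_mem (add_mem (Ideal.mul_mem_left _ _ (Ideal.mul_mem_mul m₁ m₂))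
      (Ideal.mul_mem_left _ _ (sub_mem (Ideal.mul_mem_mul m₁ n₂) (Ideal.mul_mem_mul n₁ m₂))))
      (Ideal.mul_mem_left _ _ (Ideal.mul_mem_mul n₁ n₂))

lemma mumford_normForm (v : (ZMod 2)[X]) :
    mumford (normForm v 1) v = Ideal.span {y2 + polyToR2 v} := by
  have h := Ideal.mem_span_singleton_self (y2 + polyToR2 v)
  apply le_antisymm
  · refine mumford_le ?_ h
    rw [← y2_add_mul_conj]
    exact Ideal.mul_mem_right _ _ h
  · rw [Ideal.span_singleton_le_iff_mem]
    exact mem_mumford_right _ _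

lemma mumford_congr {u v v' : (ZMod 2)[X]} (h : u ∣ v - v') : mumford u v = mumford u v' := by
  obtain ⟨w, hw⟩ := h
  have hw' := congrArg polyToR2 hw
  rw [map_sub, map_mul] at hw'
  apply le_antisymm <;> refine mumford_le (mem_mumford_left _ _) ?_
  · rw [show y2 + polyToR2 v = y2 + polyToR2 v' + polyToR2 w * polyToR2 u by
      linear_combination hw']
    exact add_mem (mem_mumford_right _ _) (Ideal.mul_mem_left _ _ (mem_mumford_left _ _))
  · rw [show y2 + polyToR2 v' = y2 + polyToR2 v - polyToR2 w * polyToR2 u by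
      linear_combination -hw']
    exact sub_mem (mem_mumford_right _ _) (Ideal.mul_mem_left _ _ (mem_mumford_left _ _))

lemma dvd_normForm_congr {u v v' : (ZMod 2)[X]} (h : u ∣ v - v') (hv : u ∣ normForm v 1) :
    u ∣ normForm v' 1 := by
  rw [show normForm v' 1 = normForm v 1 - (v - v') * (v + v' - X) by unfold normForm; ring]
  exact dvd_sub hv (h.mul_right _)

lemma not_principal_mumford {u v : (ZMod 2)[X]} (huv : u ∣ normForm v 1) (hu : 0 < u.natDegree)
    (hu' : u.natDegree ≤ 2) (g : R2) : mumford u v ≠ Ideal.span {g} := by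
  intro hg
  obtain ⟨a, b, rfl⟩ := exists_repr g
  have hu0 : u ≠ 0 := ne_zero_of_natDegree_gt hu
  have h₁ := mem_mumford_left u v
  have h₂ := mem_mumford_right u v
  rw [hg, Ideal.mem_span_singleton'] at h₁ h₂
  obtain ⟨k, hk⟩ := h₁
  obtain ⟨l, hl⟩ := h₂
  obtain ⟨c, d, rfl⟩ := exists_repr k
  obtain ⟨c', d', rfl⟩ := exists_repr l
  rw [repr_mul] at hk hl
  obtain ⟨e₁, e₂⟩ := repr_inj (c := u) (d := 0) (by rw [hk]; simp)
  obtain ⟨-, e₄⟩ := repr_inj (c := v) (d := 1) (by rw [hl]; simp [add_comm])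
  have hn := normForm_mul c d a b
  rw [e₁, e₂, show normForm u 0 = u ^ 2 by simp [normForm]] at hn
  have hb : b = 0 := by
    by_contra hb
    have h5 := five_le_natDegree_normForm a hb
    have h0 : normForm c d * normForm a b ≠ 0 := hn ▸ pow_ne_zero 2 hu0
    have := congrArg natDegree hn
    rw [natDegree_pow, natDegree_mul (left_ne_zero_of_mul h0) (right_ne_zero_of_mul h0)] at this
    omega
  subst hb
  have h1 : (polyToR2 1 + polyToR2 0 * y2) ∈ mumford u v := by
    rw [hg, Ideal.mem_span_singleton']
    refine ⟨polyToR2 d', ?_⟩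
    rw [← show c' * 0 + d' * a - d' * 0 * X = 1 from e₄]
    simp
  have := dvd_of_mem_mumford huv h1
  rw [zero_mul, sub_zero] at this
  have := natDegree_eq_zero_of_isUnit (isUnit_of_dvd_one this)
  omega

lemma span_singleton_mul_mumford (z : R2) (u v : (ZMod 2)[X]) :
    Ideal.span {z} * mumford u v = Ideal.span {z * polyToR2 u, z * (y2 + polyToR2 v)} := by
  rw [mumford, Ideal.span_mul_span', Set.singleton_mul, Set.image_pair]

lemma mumford_flip {u w v : (ZMod 2)[X]} (h : normForm v 1 = u * w) :
    Ideal.span {y2 + polyToR2 (v + X)} * mumford u v =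
      Ideal.span {polyToR2 u} * mumford w (v + X) := by
  rw [span_singleton_mul_mumford, span_singleton_mul_mumford, mul_comm _ (y2 + polyToR2 v),
    y2_add_mul_conj, h, map_mul, Set.pair_comm, mul_comm (polyToR2 u) (y2 + _)]

lemma normForm_add_X (v : (ZMod 2)[X]) : normForm (v + X) 1 = normForm v 1 := by
  unfold normForm
  linear_combination v * X * CharTwo.two_eq_zero (R := (ZMod 2)[X])

/-- Two ideals are in the same class. -/
def SameClass (I J : Ideal R2) : Prop :=
  ∃ x y : R2, x ≠ 0 ∧ y ≠ 0 ∧ Ideal.span {x} * I = Ideal.span {y} * J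

lemma SameClass.symm {I J : Ideal R2} : SameClass I J → SameClass J I := fun ⟨x, y, hx, hy, h⟩ =>
  ⟨y, x, hy, hx, h.symm⟩

lemma SameClass.trans [IsDomain R2] {I J K : Ideal R2} :
    SameClass I J → SameClass J K → SameClass I K :=
  fun ⟨x, y, hx, hy, h⟩ ⟨z, w, hz, hw, h'⟩ => ⟨z * x, y * w, mul_ne_zero hz hx, mul_ne_zero hy hw, by
    rw [← Ideal.span_singleton_mul_span_singleton, ← Ideal.span_singleton_mul_span_singleton,
      mul_assoc, h, mul_left_comm, h', mul_assoc]⟩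

lemma exists_reduced [IsDomain R2] (n : ℕ) : ∀ u v : (ZMod 2)[X], u.natDegree ≤ n → u ≠ 0 →
    u ∣ normForm v 1 → ∃ u' v' : (ZMod 2)[X], u'.natDegree ≤ 2 ∧ u' ≠ 0 ∧ v'.degree < u'.degree ∧
      u' ∣ normForm v' 1 ∧ SameClass (mumford u v) (mumford u' v') := by
  induction n using Nat.strong_induction_on with
  | _ n ih =>
    intro u v hn hu huv
    have hd : u ∣ v - v % u := ⟨v / u, by
      linear_combination -EuclideanDomain.div_add_mod v u⟩
    have hlt : (v % u).degree < u.degree := degree_mod_lt v hu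
    have huv' := dvd_normForm_congr hd huv
    rw [mumford_congr hd]
    generalize v % u = v at *
    rcases le_or_gt u.natDegree 2 with h2 | h2
    · exact ⟨u, v, h2, hu, hlt, huv', 1, 1, one_ne_zero, one_ne_zero, rfl⟩
    · obtain ⟨w, hw⟩ := huv'
      have hvn : v.natDegree < u.natDegree := by
        rcases eq_or_ne v 0 with rfl | hv
        · rw [natDegree_zero]; omega
        · exact natDegree_lt_natDegree hv hlt
      have h0 : u * w ≠ 0 := by
        rw [← hw]
        intro h
        simpa [h] using five_le_natDegree_normForm v (one_ne_zero)
      have hw0 := right_ne_zero_of_mul h0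
      have hdeg : (normForm v 1).natDegree ≤ max (2 * v.natDegree) (max (v.natDegree + 1) 5) := by
        rw [normForm, mul_one, one_pow, one_mul]
        have h1 := natDegree_add_le (v ^ 2 - v * X) curvePoly
        have h3 := natDegree_sub_le (v ^ 2) (v * X)
        have h4 : (v * X).natDegree ≤ v.natDegree + 1 :=
          natDegree_mul_le_of_le le_rfl natDegree_X_le
        rw [natDegree_pow] at h3
        rw [natDegree_curvePoly] at h1
        omega
      rw [hw, natDegree_mul hu hw0] at hdeg
      obtain ⟨u', v', a, b, c, d, e⟩ := ih w.natDegree (by omega) w (v + X) le_rfl hw0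
        (by rw [normForm_add_X, hw]; exact dvd_mul_left _ _)
      exact ⟨u', v', a, b, c, d, .trans
        ⟨_, _, y2_add_ne_zero _, polyToR2_ne_zero hu, mumford_flip hw⟩ e⟩

lemma exists_mumford [IsDomain R2] {I : Ideal R2} (hI : I ≠ ⊥) :
    ∃ u v : (ZMod 2)[X], u ≠ 0 ∧ u ∣ normForm v 1 ∧ SameClass I (mumford u v) := by
  let B : Ideal (ZMod 2)[X] :=
    { carrier := {b | ∃ a, polyToR2 a + polyToR2 b * y2 ∈ I}
      zero_mem' := ⟨0, by simp⟩
      add_mem' := by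
        rintro b b' ⟨a, h⟩ ⟨a', h'⟩
        refine ⟨a + a', ?_⟩
        convert add_mem h h' using 1
        rw [map_add, map_add]; ring
      smul_mem' := by
        rintro c b ⟨a, h⟩
        refine ⟨c * a, ?_⟩
        convert I.mul_mem_left (polyToR2 c) h using 1
        rw [smul_eq_mul, map_mul, map_mul]; ring }
  obtain ⟨d, hd⟩ := (inferInstance : B.IsPrincipal)
  obtain ⟨e, he⟩ := (inferInstance : (I.comap polyToR2).IsPrincipal)
  have hB : ∀ a b, polyToR2 a + polyToR2 b * y2 ∈ I → d ∣ b := fun a b h =>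
    by
    have hb : b ∈ B := ⟨a, h⟩
    rw [hd] at hb
    exact Ideal.mem_span_singleton.mp hb
  have hA : ∀ a, polyToR2 a ∈ I → e ∣ a := fun a h =>
    by
    have ha : a ∈ I.comap polyToR2 := h
    rw [he] at ha
    exact Ideal.mem_span_singleton.mp ha
  have heI : polyToR2 e ∈ I := by
    have : e ∈ I.comap polyToR2 := he ▸ Ideal.mem_span_singleton_self e
    exact this
  obtain ⟨a, haI⟩ : d ∈ B := hd ▸ Ideal.mem_span_singleton_self d
  have he0 : e ≠ 0 := by
    obtain ⟨g, hg, hg0⟩ := Submodule.exists_mem_ne_zero_of_ne_bot hI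
    obtain ⟨s, t, rfl⟩ := exists_repr g
    intro h0
    have := hA (normForm s t) (by rw [← mul_conj]; exact I.mul_mem_right _ hg)
    rw [h0, zero_dvd_iff] at this
    exact normForm_ne_zero hg0 this
  obtain ⟨u, rfl⟩ : d ∣ e := hB 0 e (by
    rw [map_zero, zero_add]; exact I.mul_mem_right _ heI)
  obtain ⟨v, rfl⟩ : d ∣ a := by
    have : d ∣ a - d * X := hB (-(d * curvePoly)) _ (by
      convert I.mul_mem_left y2 haI using 1
      simp only [map_sub, map_neg, map_mul]
      linear_combination -polyToR2 d * y2_sq)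
    simpa using dvd_add this (dvd_mul_right d X)
  have hd0 := left_ne_zero_of_mul he0
  refine ⟨u, v, right_ne_zero_of_mul he0, ?_, 1, polyToR2 d, one_ne_zero,
    polyToR2_ne_zero hd0, ?_⟩
  · refine (mul_dvd_mul_iff_left hd0).mp (hA _ ?_)
    convert I.mul_mem_right (y2 + polyToR2 (v + X)) haI using 1
    rw [map_mul, ← y2_add_mul_conj, map_mul]; ring
  · rw [Ideal.span_singleton_one, Ideal.top_mul, span_singleton_mul_mumford]
    apply le_antisymm
    · intro g hg
      obtain ⟨s, t, rfl⟩ := exists_repr g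
      obtain ⟨t, rfl⟩ := hB _ _ hg
      obtain ⟨r, hr⟩ : d * u ∣ s - t * (d * v) := hA _ (by
        convert sub_mem hg (I.mul_mem_left (polyToR2 t) haI) using 1
        simp only [map_sub, map_mul]; ring)
      refine Ideal.mem_span_pair.mpr ⟨polyToR2 r, polyToR2 t, ?_⟩
      have := congrArg polyToR2 hr
      simp only [map_sub, map_mul] at this ⊢
      linear_combination -this
    · rw [Ideal.span_le]
      rintro z (rfl | rfl)
      · rw [← map_mul]; exact heI
      · have : polyToR2 d * (y2 + polyToR2 v) = polyToR2 (d * v) + polyToR2 d * y2 := by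
          rw [map_mul]; ring
        rw [this]; exact haI

/-- The reduced Mumford representations. -/
def reducedPair : Fin 10 → (ZMod 2)[X] × (ZMod 2)[X] :=
  ![(1, 0), (X, 0), (X + 1, 0), (X + 1, 1), (X ^ 2 + X, 0), (X ^ 2 + X, X),
    (X ^ 2 + 1, 1), (X ^ 2 + 1, X + 1), (X ^ 2 + X + 1, 1), (X ^ 2 + X + 1, X + 1)]

lemma eq_of_natDegree_le_two {R : Type*} [Semiring R] {p : R[X]} (h : p.natDegree ≤ 2) :
    p = C (p.coeff 2) * X ^ 2 + C (p.coeff 1) * X + C (p.coeff 0) := by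
  conv_lhs => rw [p.as_sum_range_C_mul_X_pow' (Nat.lt_succ_of_le h)]
  simp only [Finset.sum_range_succ, Finset.sum_range_zero, pow_zero, pow_one, mul_one, zero_add]
  abel

lemma ZMod_two_eq_one : ∀ {a : ZMod 2}, a ≠ 0 → a = 1 := by decide

lemma coeff_condition_quadratic {b c d e : ZMod 2}
    (h : X ^ 2 + C b * X + C c ∣ normForm (C d * X + C e) 1) :
    (2 * d * e - e + 1) - c * (1 - c + b ^ 2) -
      b * ((d ^ 2 - d + 1) - b * (1 - c + b ^ 2) + b * c) = 0 ∧
    e ^ 2 - c * ((d ^ 2 - d + 1) - b * (1 - c + b ^ 2) + b * c) = 0 := by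
  set p := 1 - c + b ^ 2 with hp
  set m := (d ^ 2 - d + 1) - b * p + b * c with hm
  set r₁ := (2 * d * e - e + 1) - c * p - b * m with hr₁
  set r₀ := e ^ 2 - c * m with hr₀
  have key : normForm (C d * X + C e) 1 =
      (X ^ 2 + C b * X + C c) * (X ^ 3 - C b * X ^ 2 + C p * X + C m) + (C r₁ * X + C r₀) := by
    simp only [hr₀, hr₁, hm, hp, map_sub, map_add, map_mul, map_pow, map_one, map_ofNat, normForm,
      curvePoly]
    ring
  rw [key, dvd_add_right (dvd_mul_right _ _)] at h
  have h0 := eq_zero_of_dvd_of_degree_lt h (by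
    refine lt_of_lt_of_eq degree_linear_lt (b := (2 : WithBot ℕ)) ?_
    have := degree_quadratic (b := b) (c := c) (one_ne_zero (α := ZMod 2))
    rw [map_one, one_mul] at this
    exact this.symm)
  exact ⟨by simpa using congrArg (coeff · 1) h0, by simpa using congrArg (coeff · 0) h0⟩

set_option synthInstance.maxHeartbeats 400000 in
set_option synthInstance.maxSize 2000 in
lemma quadratic_solutions : ∀ b c d e : ZMod 2,
    (2 * d * e - e + 1) - c * (1 - c + b ^ 2) -
      b * ((d ^ 2 - d + 1) - b * (1 - c + b ^ 2) + b * c) = 0 →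
    e ^ 2 - c * ((d ^ 2 - d + 1) - b * (1 - c + b ^ 2) + b * c) = 0 →
    ((b = 1 ∧ c = 0 ∧ e = 0) ∨ (b = 0 ∧ c = 1 ∧ e = 1) ∨ (b = 1 ∧ c = 1 ∧ e = 1)) ∧
        (d = 0 ∨ d = 1) := by decide

lemma coeff_condition_linear {c e : ZMod 2} (h : X + C c ∣ normForm (C e) 1) :
    c = 1 ∨ e = 0 := by
  obtain ⟨w, hw⟩ := h
  have := congrArg (eval c) hw
  simp only [normForm, curvePoly, eval_add, eval_sub, eval_mul, eval_pow, eval_X, eval_C,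
    eval_one, CharTwo.add_self_eq_zero, zero_mul] at this
  clear hw w
  revert c e
  decide

lemma exists_reducedPair {u v : (ZMod 2)[X]} (hdeg : u.natDegree ≤ 2) (hu : u ≠ 0)
    (hv : v.degree < u.degree) (huv : u ∣ normForm v 1) : ∃ i, reducedPair i = (u, v) := by
  have hu2 := eq_of_natDegree_le_two hdeg
  have hlc : u.leadingCoeff = 1 := ZMod_two_eq_one (leadingCoeff_ne_zero.mpr hu)
  rw [leadingCoeff] at hlc
  rw [degree_eq_natDegree hu] at hv
  interval_cases hn : u.natDegree
  · have hv0 : v = 0 := by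
      rw [degree_lt_iff_coeff_zero] at hv
      ext n; simpa using hv n
    rw [coeff_eq_zero_of_natDegree_lt (n := 1) (by omega),
      coeff_eq_zero_of_natDegree_lt (n := 2) (by omega), hlc] at hu2
    exact ⟨0, by rw [hv0, hu2]; simp [reducedPair]⟩
  · have hv0 : v = C (v.coeff 0) := eq_C_of_degree_le_zero (Order.le_of_lt_succ hv)
    rw [coeff_eq_zero_of_natDegree_lt (n := 2) (by omega), hlc] at hu2
    simp only [map_zero, zero_mul, zero_add, map_one, one_mul] at hu2
    generalize u.coeff 0 = c at hu2
    generalize v.coeff 0 = e at hv0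
    subst hu2 hv0
    have h := coeff_condition_linear huv
    have : (c = 0 ∧ e = 0) ∨ (c = 1 ∧ e = 0) ∨ (c = 1 ∧ e = 1) := by
      clear * - h
      revert c e; decide
    rcases this with ⟨rfl, rfl⟩ | ⟨rfl, rfl⟩ | ⟨rfl, rfl⟩
    · exact ⟨1, by simp [reducedPair]⟩
    · exact ⟨2, by simp [reducedPair]⟩
    · exact ⟨3, by simp [reducedPair]⟩
  · have hv0 : v = C (v.coeff 1) * X + C (v.coeff 0) :=
      eq_X_add_C_of_degree_le_one (Order.le_of_lt_succ hv)
    rw [hlc, map_one, one_mul] at hu2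
    generalize u.coeff 0 = c at hu2
    generalize u.coeff 1 = b at hu2
    generalize v.coeff 0 = e at hv0
    generalize v.coeff 1 = d at hv0
    subst hu2 hv0
    obtain ⟨h₁, h₀⟩ := coeff_condition_quadratic huv
    obtain ⟨⟨rfl, rfl, rfl⟩ | ⟨rfl, rfl, rfl⟩ | ⟨rfl, rfl, rfl⟩, rfl | rfl⟩ :=
      quadratic_solutions _ _ _ _ h₁ h₀
    · exact ⟨4, by simp [reducedPair]⟩
    · exact ⟨5, by simp [reducedPair]⟩
    · exact ⟨6, by simp [reducedPair]⟩
    · exact ⟨7, by simp [reducedPair]⟩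
    · exact ⟨8, by simp [reducedPair]⟩
    · exact ⟨9, by simp [reducedPair]⟩

lemma exists_sameClass_reducedPair [IsDomain R2] {I : Ideal R2} (hI : I ≠ ⊥) :
    ∃ i, SameClass I (mumford (reducedPair i).1 (reducedPair i).2) := by
  obtain ⟨u, v, hu, huv, h⟩ := exists_mumford hI
  obtain ⟨u', v', h2, hu', hlt, huv', h'⟩ := exists_reduced _ u v le_rfl hu huv
  obtain ⟨i, hi⟩ := exists_reducedPair h2 hu' hlt huv'
  exact ⟨i, by rw [hi]; exact h.trans h'⟩

open scoped nonZeroDivisors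

lemma exists_mk_eq {R : Type*} [CommRing R] [IsDomain R] (c : ClassGroup R) :
    ∃ (U : (FractionalIdeal R⁰ (FractionRing R))ˣ) (I : Ideal R), I ≠ ⊥ ∧
      (U : FractionalIdeal R⁰ (FractionRing R)) = I ∧ c = ClassGroup.mk (FractionRing R) U := by
  refine ClassGroup.induction (FractionRing R) (fun J => ?_) c
  obtain ⟨U, hU⟩ := FractionalIdeal.isUnit_num.mpr J.isUnit
  have hden : algebraMap R (FractionRing R) (J : FractionalIdeal R⁰ (FractionRing R)).den ≠ 0 :=
    IsFractionRing.to_map_ne_zero_of_mem_nonZeroDivisors (SetLike.coe_mem _)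
  refine ⟨U, _, ?_, hU, ClassGroup.mk_eq_mk.mpr ⟨Units.mk0 _ hden, ?_⟩⟩
  · intro h
    rw [h, FractionalIdeal.coeIdeal_bot] at hU
    exact U.ne_zero hU
  · ext1
    rw [hU, Units.val_mul, coe_toPrincipalIdeal, Units.val_mk0, mul_comm,
      FractionalIdeal.den_mul_self_eq_num']

lemma exists_injective_classGroup [IsDomain R2] :
    ∃ φ : ClassGroup R2 → Fin 10, Function.Injective φ := by
  choose U I hI hU hc using exists_mk_eq (R := R2)
  choose φ hφ using fun c => exists_sameClass_reducedPair (hI c)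
  refine ⟨φ, fun c c' h => ?_⟩
  rw [hc c, hc c', ClassGroup.mk_eq_mk_of_coe_ideal (hU c) (hU c')]
  have := hφ c'
  rw [← h] at this
  exact (hφ c).trans this.symm

lemma exists_unit_coe_eq {R : Type*} [CommRing R] [IsDomain R] {I J : Ideal R} {x : R}
    (hx : x ≠ 0) (h : I * J = Ideal.span {x}) :
    ∃ U : (FractionalIdeal R⁰ (FractionRing R))ˣ,
      (U : FractionalIdeal R⁰ (FractionRing R)) = I := by
  have hu : IsUnit ((I * J : Ideal R) : FractionalIdeal R⁰ (FractionRing R)) := by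
    rw [h, FractionalIdeal.coeIdeal_span_singleton]
    exact ⟨toPrincipalIdeal R _ (Units.mk0 _
      (IsFractionRing.to_map_ne_zero_of_mem_nonZeroDivisors
        (mem_nonZeroDivisors_of_ne_zero hx))), by simp⟩
  rw [FractionalIdeal.coeIdeal_mul] at hu
  exact isUnit_of_mul_isUnit_left hu

/-- The function `y + x³ + x²` has norm `x (x + 1)⁵`. -/
lemma normForm_cubic : normForm (X ^ 3 + X ^ 2) 1 = (X + 1) ^ 5 * X := by
  have h2 := CharTwo.two_eq_zero (R := (ZMod 2)[X])
  unfold normForm curvePoly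
  linear_combination (-1 * X ^ 5 - 5 * X ^ 4 - 5 * X ^ 3 - 2 * X ^ 2 : (ZMod 2)[X]) * h2

lemma exists_orderOf_eq_ten [IsDomain R2] : ∃ c : ClassGroup R2, orderOf c = 10 := by
  set v : (ZMod 2)[X] := X ^ 3 + X ^ 2 with hv
  have h2 := CharTwo.two_eq_zero (R := (ZMod 2)[X])
  have hN : normForm v 1 = (X + 1) ^ 5 * X := normForm_cubic
  have hX1 : (X + 1 : (ZMod 2)[X]).natDegree = 1 := natDegree_X_add_C 1
  have hX10 : (X + 1 : (ZMod 2)[X]) ≠ 0 := X_add_C_ne_zero 1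
  have hpow : ∀ n ≤ 5, mumford (X + 1) v ^ n = mumford ((X + 1) ^ n) v := by
    intro n hn
    induction n with
    | zero =>
      rw [pow_zero, pow_zero, Ideal.one_eq_top, eq_comm, Ideal.eq_top_iff_one, ← map_one polyToR2]
      exact mem_mumford_left _ _
    | succ n ih =>
      rw [pow_succ, ih (by omega), pow_succ]
      refine mumford_mul (r := 0) (s := 1) (t := 1) ?_ (by linear_combination X * h2)
      rw [← pow_succ, hN]
      exact (pow_dvd_pow _ hn).mul_right _
  obtain ⟨P, hP⟩ := exists_unit_coe_eq (polyToR2_ne_zero hX10)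
    (mumford_mul_conj (v := v) (w := (X + 1) ^ 4 * X) (r := 1) (s := 1) (t := 0)
      (by rw [hN]; ring) (by linear_combination X * h2))
  have hQQ : mumford X v * mumford X v = Ideal.span {polyToR2 X} := by
    have h := mumford_mul_conj (v := v) (u := X) (w := (X + 1) ^ 5)
      (r := -(X ^ 4 + 5 * X ^ 3 + 10 * X ^ 2 + 10 * X + 5)) (s := 0) (t := 1)
      (by rw [hN]; ring) (by ring)
    rwa [mumford_congr (v := v + X) (v' := v) (by simp)] at h
  obtain ⟨Q, hQ⟩ := exists_unit_coe_eq (polyToR2_ne_zero X_ne_zero) hQQ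
  have hQ2 : ClassGroup.mk (FractionRing R2) Q ^ 2 = 1 := by
    rw [← map_pow, ClassGroup.mk_eq_one_of_coe_ideal (I' := mumford X v * mumford X v)
      (by rw [Units.val_pow_eq_pow_val, hQ, FractionalIdeal.coeIdeal_mul, sq])]
    exact ⟨_, polyToR2_ne_zero X_ne_zero, hQQ⟩
  have hPQ : ClassGroup.mk (FractionRing R2) P ^ 5 * ClassGroup.mk (FractionRing R2) Q = 1 := by
    rw [← map_pow, ← map_mul,
      ClassGroup.mk_eq_one_of_coe_ideal (I' := mumford (X + 1) v ^ 5 * mumford X v)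
      (by rw [Units.val_mul, Units.val_pow_eq_pow_val, hP, hQ, FractionalIdeal.coeIdeal_mul,
        FractionalIdeal.coeIdeal_pow])]
    refine ⟨_, y2_add_ne_zero v, ?_⟩
    rw [hpow 5 le_rfl, mumford_mul (r := 1) (t := 0)
      (s := -(X ^ 4 + 5 * X ^ 3 + 10 * X ^ 2 + 10 * X + 5)) hN.symm.dvd (by ring), ← hN,
      mumford_normForm]
  have hQ1 : ClassGroup.mk (FractionRing R2) Q ≠ 1 := by
    rw [Ne, ClassGroup.mk_eq_one_of_coe_ideal hQ]
    rintro ⟨g, -, hg⟩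
    exact not_principal_mumford (hN ▸ dvd_mul_left _ _) (by simp) (by simp) g hg
  have hP2 : ClassGroup.mk (FractionRing R2) P ^ 2 ≠ 1 := by
    rw [← map_pow, Ne, ClassGroup.mk_eq_one_of_coe_ideal (I' := mumford (X + 1) v ^ 2)
      (by rw [Units.val_pow_eq_pow_val, hP, FractionalIdeal.coeIdeal_pow])]
    rintro ⟨g, -, hg⟩
    rw [hpow 2 (by norm_num)] at hg
    refine not_principal_mumford ?_ ?_ ?_ g hg
    · rw [hN]
      exact (pow_dvd_pow _ (by norm_num)).mul_right _
    all_goals rw [natDegree_pow, hX1]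
    norm_num
  refine ⟨ClassGroup.mk (FractionRing R2) P,
    orderOf_eq_of_pow_and_pow_div_prime (by norm_num) ?_ ?_⟩
  · rw [show 10 = 5 * 2 by norm_num, pow_mul, eq_inv_of_mul_eq_one_left hPQ, inv_pow, hQ2, inv_one]
  · intro p hp hdvd
    have hp' : p = 2 ∨ p = 5 := by
      rw [show 10 = 2 * 5 by norm_num, hp.dvd_mul] at hdvd
      exact hdvd.imp (Nat.prime_dvd_prime_iff_eq hp Nat.prime_two).mp
        (Nat.prime_dvd_prime_iff_eq hp Nat.prime_five).mp
    rcases hp' with rfl | rfl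
    · intro h
      rw [show 10 / 2 = 5 by norm_num] at h
      rw [h, one_mul] at hPQ
      exact hQ1 hPQ
    · exact hP2

/-- The ideal class group of `R₂` is finite of cardinality 10.
(The hypothesis `IsDomain R2` is a true fact, supplied so that `ClassGroup R2` makes sense.) -/
theorem stmt_4 [IsDomain R2] : Nat.card (ClassGroup R2) = 10 := by
  obtain ⟨φ, hφ⟩ := exists_injective_classGroup
  obtain ⟨c, hc⟩ := exists_orderOf_eq_ten
  have : Finite (ClassGroup R2) := Finite.of_injective φ hφ
  have h₁ := Nat.card_le_card_of_injective φ hφ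
  rw [Nat.card_fin] at h₁
  have h₂ := Nat.le_of_dvd Nat.card_pos (hc ▸ orderOf_dvd_natCard c)
  exact le_antisymm h₁ h₂
end
end

section
/- Let R₅ = 𝔽₅[X,Y]/(Y² − X⁵ + X³ − X). Then the ideal class group ClassGroup(R₅) is isomorphic, as a group, to (ℤ/8ℤ) × (ℤ/8ℤ); in particular it has cardinality 64. -/
noncomputable section

open Polynomial

instance : Fact (Nat.Prime 5) := ⟨by norm_num⟩

/-- The polynomial `Y² − (X⁵ − X³ + X)` as an element of `𝔽₅[X][Y]`
(the outer variable is `Y`, the inner variable is `X`). -/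
def f5 : Polynomial (Polynomial (ZMod 5)) :=
  X ^ 2 - C (X ^ 5 - X ^ 3 + X)

/-- The ring `R₅ = 𝔽₅[X,Y]/(Y² − X⁵ + X³ − X)`. -/
def R5 : Type := Polynomial (Polynomial (ZMod 5)) ⧸ Ideal.span {f5}

instance : CommRing R5 := Ideal.Quotient.commRing _

/-- The quotient map `𝔽₅[X][Y] → R₅`. -/
def toR5 : Polynomial (Polynomial (ZMod 5)) →+* R5 :=
  Ideal.Quotient.mk (Ideal.span {f5})

/-- The image `x` of `X` in `R₅`. -/
def x5 : R5 := toR5 (C X)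

/-- The image `y` of `Y` in `R₅`. -/
def y5 : R5 := toR5 X

namespace R5

/-- The quintic `X⁵ - X³ + X` on the right-hand side of the equation of the curve. -/
def quintic : (ZMod 5)[X] := X ^ 5 - X ^ 3 + X

/-- The inclusion `𝔽₅[X] → R₅`. -/
def base : (ZMod 5)[X] →+* R5 := toR5.comp C

lemma y5_mul_self : y5 * y5 = base quintic := by
  have h : toR5 f5 = 0 := Ideal.Quotient.eq_zero_iff_mem.2 (Ideal.mem_span_singleton_self f5)
  rw [f5, map_sub, sub_eq_zero, map_pow, sq] at h
  exact h

lemma natDegree_f5 : f5.natDegree = 2 := natDegree_X_pow_sub_C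

lemma monic_f5 : f5.Monic := monic_X_pow_sub_C _ two_ne_zero

lemma exists_eq_base_add (z : R5) : ∃ c d, z = base c + base d * y5 := by
  obtain ⟨P, rfl⟩ : ∃ P, toR5 P = z := Ideal.Quotient.mk_surjective z
  have hdeg : (P %ₘ f5).natDegree ≤ 1 := by
    have := natDegree_modByMonic_lt P monic_f5
      (fun h => by simpa [h] using natDegree_f5)
    rw [natDegree_f5] at this
    omega
  obtain ⟨d, c, hdc⟩ := exists_eq_X_add_C_of_natDegree_le_one hdeg
  have hP : toR5 P = toR5 (P %ₘ f5) := by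
    rw [← sub_eq_zero, ← map_sub]
    refine Ideal.Quotient.eq_zero_iff_mem.2 (Ideal.mem_span_singleton.2 ⟨P /ₘ f5, ?_⟩)
    linear_combination -modByMonic_add_div P f5
  refine ⟨c, d, ?_⟩
  rw [hP, hdc, map_add, map_mul, add_comm]
  rfl

lemma eq_zero_of_base_add_eq_zero {c d : (ZMod 5)[X]} (h : base c + base d * y5 = 0) :
    c = 0 ∧ d = 0 := by
  have hmem : f5 ∣ C d * X + C c := by
    rw [← Ideal.mem_span_singleton, ← Ideal.Quotient.eq_zero_iff_mem]
    rw [add_comm] at h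
    exact ((map_add toR5 _ _).trans (congrArg (· + _) (map_mul toR5 _ _))).trans h
  have h0 : C d * X + C c = 0 := by
    refine eq_zero_of_dvd_of_natDegree_lt hmem ?_
    rw [natDegree_f5]
    exact natDegree_linear_le.trans_lt one_lt_two
  constructor
  · simpa using congrArg (coeff · 0) h0
  · simpa using congrArg (coeff · 1) h0

lemma base_add_inj {c d c' d' : (ZMod 5)[X]}
    (h : base c + base d * y5 = base c' + base d' * y5) : c = c' ∧ d = d' := by
  have := @eq_zero_of_base_add_eq_zero (c - c') (d - d') (by
    simp only [map_sub]; linear_combination h)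
  exact ⟨sub_eq_zero.1 this.1, sub_eq_zero.1 this.2⟩

lemma base_add_mul (a b c d : (ZMod 5)[X]) :
    (base a + base b * y5) * (base c + base d * y5) =
      base (a * c + b * d * quintic) + base (a * d + b * c) * y5 := by
  simp only [map_add, map_mul]
  linear_combination base b * base d * y5_mul_self

lemma base_injective : Function.Injective base := fun c c' h =>
  (base_add_inj (d := 0) (d' := 0) (by rw [h])).1

lemma five_eq_zero : (5 : (ZMod 5)[X]) = 0 := by
  have : ((5 : ℕ) : (ZMod 5)[X]) = 0 := CharP.cast_eq_zero _ 5
  exact_mod_cast this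

lemma natDegree_quintic : quintic.natDegree = 5 := by
  unfold quintic; compute_degree!

lemma squarefree_quintic : Squarefree quintic := by
  refine Separable.squarefree ⟨X, 2 * X ^ 4 + 2 * X ^ 2 + 1, ?_⟩
  simp only [quintic, derivative_add, derivative_sub, derivative_X_pow, derivative_X]
  push_cast
  simp only [map_ofNat]
  linear_combination (2 * X ^ 8 + X ^ 6) * five_eq_zero

lemma isUnit_of_sq_dvd_quintic {p : (ZMod 5)[X]} (h : p ^ 2 ∣ quintic) : IsUnit p :=
  squarefree_quintic p (by rwa [← sq])

/-- The ideal of `R₅` generated by `u(x)` and `y - v(x)` (the Mumford representation). -/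
def mumford (u v : (ZMod 5)[X]) : Ideal R5 := Ideal.span {base u, y5 - base v}

lemma base_add_mem_mumford {u v c d : (ZMod 5)[X]} (huv : u ∣ v ^ 2 - quintic)
    (h : base c + base d * y5 ∈ mumford u v) : u ∣ c + d * v := by
  obtain ⟨a, b, hab⟩ := Ideal.mem_span_pair.1 h
  obtain ⟨a₀, a₁, rfl⟩ := exists_eq_base_add a
  obtain ⟨b₀, b₁, rfl⟩ := exists_eq_base_add b
  obtain ⟨k, hk⟩ := huv
  obtain ⟨h₀, h₁⟩ := @base_add_inj (a₀ * u - b₀ * v + b₁ * quintic) (a₁ * u + b₀ - b₁ * v) c d (by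
    rw [← hab]; simp only [map_add, map_sub, map_mul]
    linear_combination -base b₁ * y5_mul_self)
  exact ⟨a₀ + a₁ * v - b₁ * k, by linear_combination -h₀ - v * h₁ - b₁ * hk⟩

lemma mumford_add_mul (u v w : (ZMod 5)[X]) : mumford u (v + u * w) = mumford u v := by
  have : y5 - base (v + u * w) = y5 - base v + base (-w) * base u := by
    simp only [map_add, map_mul, map_neg]; ring
  rw [mumford, mumford, this, Ideal.span_pair_add_mul_left]

lemma mumford_ne_bot (u v : (ZMod 5)[X]) : mumford u v ≠ ⊥ := by
  intro h
  have hy : y5 - base v = 0 := by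
    rw [← Ideal.mem_bot, ← h]
    exact Ideal.subset_span (by simp)
  have := (@eq_zero_of_base_add_eq_zero (-v) 1 (by simpa using (by linear_combination hy))).2
  exact one_ne_zero this

lemma mumford_of_isUnit {u : (ZMod 5)[X]} (hu : IsUnit u) (v : (ZMod 5)[X]) :
    mumford u v = ⊤ :=
  Ideal.eq_top_of_isUnit_mem _ (Ideal.subset_span (by simp)) (hu.map base)

lemma mumford_sub_quintic (v : (ZMod 5)[X]) :
    mumford (v ^ 2 - quintic) v = Ideal.span {y5 - base v} := by
  refine le_antisymm (Ideal.span_le.2 ?_) (Ideal.span_mono (by simp))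
  rintro _ (rfl | rfl)
  · refine Ideal.mem_span_singleton.2 ⟨-(y5 + base v), ?_⟩
    simp only [map_sub, map_pow]
    linear_combination y5_mul_self
  · exact Ideal.mem_span_singleton_self _

lemma exists_combination_eq_one {a b c : (ZMod 5)[X]}
    (h : ∀ p, p ∣ a → p ∣ b → p ∣ c → IsUnit p) : ∃ r s t, r * a + s * b + t * c = 1 := by
  obtain ⟨g, hg⟩ := IsPrincipalIdealRing.principal (Ideal.span {a, b, c})
  have hdvd : ∀ x ∈ ({a, b, c} : Set (ZMod 5)[X]), g ∣ x := fun x hx =>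
    Ideal.mem_span_singleton.1 (hg.le (Ideal.subset_span hx))
  have hunit := h g (hdvd a (by simp)) (hdvd b (by simp)) (hdvd c (by simp))
  have hone : (1 : (ZMod 5)[X]) ∈ Ideal.span {a, b, c} := by
    rw [hg]
    exact Ideal.mem_span_singleton.2 hunit.dvd
  obtain ⟨r, z, hz, hr⟩ := Ideal.mem_span_insert.1 hone
  obtain ⟨s, t, hst⟩ := Ideal.mem_span_pair.1 hz
  exact ⟨r, s, t, by rw [hr, ← hst, add_assoc]⟩

lemma isUnit_of_sq_dvd {p w n : (ZMod 5)[X]} (hn : n ∣ w ^ 2 - quintic) (hpn : p ^ 2 ∣ n)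
    (hpw : p ∣ w) : IsUnit p := by
  refine isUnit_of_sq_dvd_quintic ?_
  have := dvd_sub (pow_dvd_pow_of_dvd hpw 2) (hpn.trans hn)
  rwa [sub_sub_cancel] at this

lemma five_eq_zero' : (5 : R5) = 0 := by
  simpa only [map_ofNat, map_zero] using congrArg base five_eq_zero

/-- Composition of Mumford representations with a common interpolating polynomial. -/
lemma mumford_mul {u₁ u₂ v : (ZMod 5)[X]} (h : u₁ * u₂ ∣ v ^ 2 - quintic) :
    mumford u₁ v * mumford u₂ v = mumford (u₁ * u₂) v := by
  obtain ⟨r, s, t, hrst⟩ := @exists_combination_eq_one u₁ u₂ v fun p h₁ h₂ hv =>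
    isUnit_of_sq_dvd h (sq p ▸ mul_dvd_mul h₁ h₂) hv
  obtain ⟨k, hk⟩ := h
  have hrst' := congrArg base hrst
  have hk' := congrArg base hk
  simp only [map_add, map_sub, map_mul, map_pow, map_one] at hrst' hk'
  rw [mumford, mumford, mumford, Ideal.span_pair_mul_span_pair]
  refine le_antisymm (Ideal.span_le.2 ?_) (Ideal.span_le.2 ?_)
  · have hy : y5 - base v ∈ Ideal.span {base (u₁ * u₂), y5 - base v} :=
      Ideal.subset_span (by simp)
    rintro _ (rfl | rfl | rfl | rfl)
    · exact Ideal.subset_span (by simp)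
    · exact Ideal.mul_mem_left _ _ hy
    · exact Ideal.mul_mem_right _ _ hy
    · exact Ideal.mul_mem_left _ _ hy
  · rintro _ (rfl | rfl)
    · exact Ideal.subset_span (by simp)
    · have key : y5 - base v = (-3 * base t * base k) * (base u₁ * base u₂) +
          (base r * (base u₁ * (y5 - base v)) + (base s * ((y5 - base v) * base u₂) +
          (-3 * base t) * ((y5 - base v) * (y5 - base v)))) := by
        linear_combination (-(y5 - base v)) * hrst' - 3 * base t * hk' +
          3 * base t * y5_mul_self - base t * base v * (y5 - base v) * five_eq_zero'
      refine Set.mem_of_eq_of_mem key (add_mem (Ideal.mul_mem_left _ _ (Ideal.subset_span (by simp)))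
        (add_mem (Ideal.mul_mem_left _ _ (Ideal.subset_span (by simp)))
        (add_mem (Ideal.mul_mem_left _ _ (Ideal.subset_span (by simp)))
        (Ideal.mul_mem_left _ _ (Ideal.subset_span (by simp))))))

lemma mumford_mul_neg {u v : (ZMod 5)[X]} (h : u ∣ v ^ 2 - quintic) :
    mumford u v * mumford u (-v) = Ideal.span {base u} := by
  obtain ⟨k, hk⟩ := h
  obtain ⟨r, s, t, hrst⟩ := @exists_combination_eq_one u k v fun p h₁ h₂ hv =>
    isUnit_of_sq_dvd hk.symm.dvd (sq p ▸ mul_dvd_mul h₁ h₂) hv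
  have hrst' := congrArg base hrst
  have hk' := congrArg base hk
  simp only [map_add, map_sub, map_mul, map_pow, map_one] at hrst' hk'
  rw [mumford, mumford, Ideal.span_pair_mul_span_pair, map_neg, sub_neg_eq_add]
  refine le_antisymm (Ideal.span_le.2 ?_) (Ideal.span_le.2 ?_)
  · have hu : base u ∈ Ideal.span {base u} := Ideal.mem_span_singleton_self _
    rintro _ (rfl | rfl | rfl | rfl)
    · exact Ideal.mul_mem_left _ _ hu
    · exact Ideal.mul_mem_right _ _ hu
    · exact Ideal.mul_mem_left _ _ hu
    · refine Ideal.mem_span_singleton.2 ⟨-base k, ?_⟩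
      linear_combination y5_mul_self - hk'
  · rintro _ rfl
    have key : base u = base r * (base u * base u) +
        ((3 * base t) * (base u * (y5 + base v)) +
        ((-3 * base t) * ((y5 - base v) * base u) +
        (-base s) * ((y5 - base v) * (y5 + base v)))) := by
      linear_combination (-base u) * hrst' - base s * hk' +
        base s * y5_mul_self - base t * base v * base u * five_eq_zero'
    refine Set.mem_of_eq_of_mem key (add_mem (Ideal.mul_mem_left _ _ (Ideal.subset_span (by simp)))
      (add_mem (Ideal.mul_mem_left _ _ (Ideal.subset_span (by simp)))
      (add_mem (Ideal.mul_mem_left _ _ (Ideal.subset_span (by simp)))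
      (Ideal.mul_mem_left _ _ (Ideal.subset_span (by simp))))))

lemma sq_ne_quintic (v : (ZMod 5)[X]) : v ^ 2 ≠ quintic := fun h => by
  have := congrArg natDegree h
  rw [natDegree_pow, natDegree_quintic] at this
  omega

/-- The polynomials occurring as the coefficient of `y` in some element of `I`. -/
def leadingIdeal (I : Ideal R5) : Ideal (ZMod 5)[X] where
  carrier := {d | ∃ c, base c + base d * y5 ∈ I}
  zero_mem' := ⟨0, by simp⟩
  add_mem' := by
    rintro d d' ⟨c, hc⟩ ⟨c', hc'⟩
    refine ⟨c + c', ?_⟩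
    have := I.add_mem hc hc'
    simp only [map_add]
    convert this using 1
    ring
  smul_mem' := by
    rintro a d ⟨c, hc⟩
    refine ⟨a * c, ?_⟩
    have := I.mul_mem_left (base a) hc
    simp only [smul_eq_mul, map_mul]
    convert this using 1
    ring

lemma exists_eq_span_mul_mumford {I : Ideal R5} (hI : I ≠ ⊥) :
    ∃ g u v, g ≠ 0 ∧ u ≠ 0 ∧ u ∣ v ^ 2 - quintic ∧ I = Ideal.span {base g} * mumford u v := by
  obtain ⟨g, hg⟩ := IsPrincipalIdealRing.principal (leadingIdeal I)
  obtain ⟨A, hA⟩ := IsPrincipalIdealRing.principal (I.comap base)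
  have hg' : ∀ {c d}, base c + base d * y5 ∈ I → g ∣ d := fun {c d} h =>
    Ideal.mem_span_singleton.1 (hg.le (⟨c, h⟩ : d ∈ leadingIdeal I))
  have hA' : ∀ {c}, base c ∈ I → A ∣ c := fun {c} h =>
    Ideal.mem_span_singleton.1 (hA.le (Ideal.mem_comap.2 h : c ∈ I.comap base))
  obtain ⟨c₀, hc₀⟩ : g ∈ leadingIdeal I := hg.ge (Ideal.mem_span_singleton_self g)
  have hAI : base A ∈ I := by
    rw [← Ideal.mem_comap, hA]
    exact Ideal.mem_span_singleton_self A
  obtain ⟨u, rfl⟩ : g ∣ A := hg' (c := 0) (by simpa using I.mul_mem_right y5 hAI)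
  obtain ⟨w, rfl⟩ : g ∣ c₀ := by
    refine hg' (c := g * quintic) ?_
    convert I.mul_mem_right y5 hc₀ using 1
    rw [map_mul]
    linear_combination -base g * y5_mul_self
  have hg0 : g ≠ 0 := by
    rintro rfl
    refine hI ((Submodule.eq_bot_iff _).2 fun z hz => ?_)
    obtain ⟨c, d, rfl⟩ := exists_eq_base_add z
    obtain rfl : d = 0 := zero_dvd_iff.1 (hg' hz)
    have : c = 0 := zero_dvd_iff.1 (by simpa using hA' (c := c) (by simpa using hz))
    simp [this]
  have huw : u ∣ w ^ 2 - quintic := by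
    refine (mul_dvd_mul_iff_left hg0).1 (hA' ?_)
    convert I.mul_mem_right (base w - y5) hc₀ using 1
    simp only [map_mul, map_sub, map_pow]
    linear_combination base g * y5_mul_self
  refine ⟨g, u, -w, hg0, ?_, by rwa [neg_sq], ?_⟩
  · rintro rfl
    exact sq_ne_quintic w (sub_eq_zero.1 (zero_dvd_iff.1 huw))
  · rw [mumford, Ideal.span_mul_span', Set.singleton_mul, Set.image_pair]
    refine le_antisymm (fun z hz => ?_) (Ideal.span_le.2 ?_)
    · obtain ⟨c, d, rfl⟩ := exists_eq_base_add z
      obtain ⟨e, rfl⟩ := hg' hz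
      obtain ⟨k, hk⟩ : g * u ∣ c - g * e * w := by
        refine hA' ?_
        convert I.sub_mem hz (I.mul_mem_left (base e) hc₀) using 1
        simp only [map_mul, map_sub]
        ring
      refine Ideal.mem_span_pair.2 ⟨base k, base e, ?_⟩
      have hk' := congrArg base hk
      simp only [map_mul, map_sub, map_neg] at hk' ⊢
      linear_combination -hk'
    · rintro _ (rfl | rfl)
      · simpa using hAI
      · refine Set.mem_of_eq_of_mem ?_ hc₀
        simp only [map_mul, map_neg]
        ring

lemma exists_mul_eq_span_singleton [IsDomain R5] {I : Ideal R5} (hI : I ≠ ⊥) :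
    ∃ (J : Ideal R5) (z : R5), z ≠ 0 ∧ I * J = Ideal.span {z} := by
  obtain ⟨g, u, v, hg, hu, huv, rfl⟩ := exists_eq_span_mul_mumford hI
  refine ⟨mumford u (-v), base g * base u, mul_ne_zero ?_ ?_, ?_⟩
  · exact (map_ne_zero_iff _ base_injective).2 hg
  · exact (map_ne_zero_iff _ base_injective).2 hu
  · rw [mul_assoc, mumford_mul_neg huv, Ideal.span_singleton_mul_span_singleton]

instance isDedekindDomain [IsDomain R5] : IsDedekindDomain R5 := by
  rw [isDedekindDomain_iff_mul_inv_cancel (K := FractionRing R5)]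
  intro I hI
  obtain ⟨a, J, ha, rfl⟩ := FractionalIdeal.exists_eq_spanSingleton_mul I
  have hJ : J ≠ ⊥ := by
    rintro rfl
    exact hI (by simp)
  obtain ⟨J', z, hz, hJJ'⟩ := exists_mul_eq_span_singleton hJ
  have hinj := FaithfulSMul.algebraMap_injective R5 (FractionRing R5)
  have ha' := (map_ne_zero_iff _ hinj).2 ha
  have hz' := (map_ne_zero_iff _ hinj).2 hz
  rw [FractionalIdeal.mul_inv_cancel_iff_isUnit]
  have hunit : ∀ x : FractionRing R5, x ≠ 0 →
      IsUnit (FractionalIdeal.spanSingleton (nonZeroDivisors R5) x) := fun x hx =>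
    .of_mul_eq_one (FractionalIdeal.spanSingleton _ x⁻¹) (by
      rw [FractionalIdeal.spanSingleton_mul_spanSingleton, mul_inv_cancel₀ hx,
        FractionalIdeal.spanSingleton_one])
  refine (hunit _ (inv_ne_zero ha')).mul (isUnit_of_mul_isUnit_left (y := (J' : FractionalIdeal _ _)) ?_)
  rw [← FractionalIdeal.coeIdeal_mul, hJJ', FractionalIdeal.coeIdeal_span_singleton]
  exact hunit _ hz'

lemma nonempty_mulEquiv_zmod_eight {G : Type*} [CommGroup G] {a b : G} (ha : a ^ 8 = 1)
    (hb : b ^ 8 = 1) (ha₄ : a ^ 4 ≠ 1) (hb₄ : b ^ 4 ≠ 1) (hab : a ^ 4 * b ^ 4 ≠ 1)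
    (htop : Subgroup.closure {a, b} = ⊤) :
    Nonempty (G ≃* Multiplicative (ZMod 8 × ZMod 8)) := by
  have hlift : ∀ c : G, c ^ 8 = 1 → ∃ g : ZMod 8 →+ Additive G,
      ∀ k : ℕ, g (k : ZMod 8) = Additive.ofMul (c ^ k) := fun c hc => by
    have h0 : zmultiplesHom (Additive G) (Additive.ofMul c) ((8 : ℕ) : ℤ) = 0 := by
      rw [zmultiplesHom_apply, natCast_zsmul, ← ofMul_pow, hc, ofMul_one]
    refine ⟨ZMod.lift 8 ⟨_, h0⟩, fun k => ?_⟩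
    have h := ZMod.lift_coe 8 ⟨_, h0⟩ (k : ℤ)
    rw [Int.cast_natCast] at h
    rw [h, zmultiplesHom_apply, natCast_zsmul, ofMul_pow]
  obtain ⟨g, hg⟩ := hlift a ha
  obtain ⟨g', hg'⟩ := hlift b hb
  let f : Multiplicative (ZMod 8 × ZMod 8) →* G := AddMonoidHom.toMultiplicativeLeft (g.coprod g')
  have hf : ∀ m n : ℕ, f (.ofAdd ((m, n) : ZMod 8 × ZMod 8)) = a ^ m * b ^ n := fun m n => by
    change Additive.toMul (g m + g' n) = _
    rw [hg, hg']
    rfl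
  have hinj : Function.Injective f := by
    rw [injective_iff_map_eq_one]
    intro x hx
    have key : ∀ x : ZMod 8 × ZMod 8, x = 0 ∨ ∃ k : Fin 8,
        k.val • x ∈ [((4, 0) : ZMod 8 × ZMod 8), (0, 4), (4, 4)] := by decide +kernel
    rcases key x.toAdd with h | ⟨k, hk⟩
    · exact h
    · have hone : f (.ofAdd (k.val • x.toAdd)) = 1 := by
        rw [ofAdd_nsmul, ofAdd_toAdd, map_pow, hx, one_pow]
      simp only [List.mem_cons, List.not_mem_nil, or_false] at hk
      rcases hk with hk | hk | hk <;> rw [hk] at hone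
      · exact absurd (by simpa using (hf 4 0).symm.trans hone) ha₄
      · exact absurd (by simpa using (hf 0 4).symm.trans hone) hb₄
      · exact absurd ((hf 4 4).symm.trans hone) hab
  have hsurj : Function.Surjective f := by
    rw [← MonoidHom.range_eq_top, eq_top_iff, ← htop, Subgroup.closure_le]
    rintro _ (rfl | rfl)
    · exact ⟨_, (hf 1 0).trans (by simp)⟩
    · exact ⟨_, (hf 0 1).trans (by simp)⟩
  exact ⟨(MulEquiv.ofBijective f ⟨hinj, hsurj⟩).symm⟩

/-- The class of the ideal generated by `u(x)` and `y - v(x)`. -/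
def mumfordClass [IsDomain R5] (u v : (ZMod 5)[X]) : ClassGroup R5 :=
  ClassGroup.mk0 ⟨mumford u v, mem_nonZeroDivisors_of_ne_zero (mumford_ne_bot u v)⟩

lemma eval_quintic (a : ZMod 5) : quintic.eval a = a ^ 5 - a ^ 3 + a := by
  simp [quintic]

lemma eq_zero_of_natDegree_sub_lt {c d : (ZMod 5)[X]}
    (h : (c ^ 2 - d ^ 2 * quintic).natDegree < 5) : d = 0 := by
  by_contra hd
  have hne : (d ^ 2 * quintic).natDegree = 2 * d.natDegree + 5 := by
    rw [natDegree_mul (pow_ne_zero 2 hd) (fun h => by simpa [h] using natDegree_quintic),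
      natDegree_pow, natDegree_quintic]
  have hsq : (c ^ 2).natDegree = 2 * c.natDegree := natDegree_pow c 2
  have hle : (d ^ 2 * quintic).natDegree ≤ (c ^ 2).natDegree := by
    by_contra! hlt
    rw [natDegree_sub_eq_right_of_natDegree_lt hlt] at h
    omega
  have hlt : (d ^ 2 * quintic).natDegree < (c ^ 2).natDegree := by omega
  rw [natDegree_sub_eq_left_of_natDegree_lt hlt] at h
  omega

lemma exists_splitting (p q r s : ZMod 5)
    (h₁ : 2 * r * s - r ^ 2 * p - (p ^ 4 - 3 * p ^ 2 * q + q ^ 2) + (p ^ 2 - q) - 1 = 0)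
    (h₂ : s ^ 2 - r ^ 2 * q - (p ^ 3 * q - 2 * p * q ^ 2) + p * q = 0) :
    (∃ e, e ^ 2 + p * e + q = 0) ∨ ∃ c a b d,
      c ^ 2 = a + b + d - p ∧
      2 * c * (c * p + r) + 1 = -(q - p * (a + b + d) + (a * b + a * d + b * d)) ∧
      (c * p + r) ^ 2 + 2 * c * (c * q + s) =
        q * (a + b + d) - p * (a * b + a * d + b * d) + a * b * d ∧
      2 * (c * p + r) * (c * q + s) - 1 = p * (a * b * d) - q * (a * b + a * d + b * d) ∧
      (c * q + s) ^ 2 = q * (a * b * d) := by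
  revert p q r s
  decide +kernel

lemma quintic_eq_mul : quintic = X * (X ^ 2 + 2 * X + 4) * (X ^ 2 + 3 * X + 4) := by
  rw [quintic]
  linear_combination (-X ^ 4 - 3 * X ^ 3 - 4 * X ^ 2 - 3 * X) * five_eq_zero

lemma natDegree_quadratic (p q : ZMod 5) : (X ^ 2 + C p * X + C q).natDegree = 2 := by
  compute_degree!

section ClassGroup

variable [IsDomain R5]

lemma mumfordClass_eq_one_iff {u v : (ZMod 5)[X]} :
    mumfordClass u v = 1 ↔ (mumford u v).IsPrincipal :=
  ClassGroup.mk0_eq_one_iff _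

lemma mumfordClass_add_mul (u v w : (ZMod 5)[X]) :
    mumfordClass u (v + u * w) = mumfordClass u v := by
  simp only [mumfordClass, mumford_add_mul]

lemma mumfordClass_of_isUnit {u : (ZMod 5)[X]} (hu : IsUnit u) (v : (ZMod 5)[X]) :
    mumfordClass u v = 1 := by
  rw [mumfordClass_eq_one_iff, mumford_of_isUnit hu]
  infer_instance

lemma mumfordClass_mul {u₁ u₂ v : (ZMod 5)[X]} (h : u₁ * u₂ ∣ v ^ 2 - quintic) :
    mumfordClass (u₁ * u₂) v = mumfordClass u₁ v * mumfordClass u₂ v := by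
  simp only [mumfordClass, ← map_mul, ← mumford_mul h]
  rfl

lemma mumfordClass_mul_eq_one {u₁ u₂ v : (ZMod 5)[X]} (h : v ^ 2 - quintic = -(u₁ * u₂)) :
    mumfordClass u₁ v * mumfordClass u₂ v = 1 := by
  have h' : v ^ 2 - quintic = u₁ * u₂ * -1 := by rw [h]; ring
  have hone : mumfordClass (v ^ 2 - quintic) v = 1 := by
    rw [mumfordClass_eq_one_iff, mumford_sub_quintic]
    exact ⟨_, rfl⟩
  rw [← mumfordClass_mul ⟨-1, h'⟩, ← hone, h', mumfordClass_mul h'.symm.dvd,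
    mumfordClass_of_isUnit isUnit_one.neg, mul_one]

lemma mumfordClass_mul_neg {u v : (ZMod 5)[X]} (h : u ∣ v ^ 2 - quintic) :
    mumfordClass u v * mumfordClass u (-v) = 1 := by
  rw [mumfordClass, mumfordClass, ← map_mul, ClassGroup.mk0_eq_one_iff]
  exact ⟨_, mumford_mul_neg h⟩

/-- The class of the ideal of the point `(a, b)`. -/
def pointClass (a b : ZMod 5) : ClassGroup R5 := mumfordClass (X - C a) (C b)

lemma mumfordClass_X_sub_C (a : ZMod 5) (v : (ZMod 5)[X]) :
    mumfordClass (X - C a) v = pointClass a (v.eval a) := by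
  obtain ⟨w, hw⟩ := X_sub_C_dvd_sub_C_eval (a := a) (p := v)
  rw [pointClass, ← mumfordClass_add_mul _ (C _) w, ← hw, add_sub_cancel]

lemma mumfordClass_prod_X_sub_C_mul (l : List (ZMod 5)) (u v : (ZMod 5)[X])
    (h : (l.map (X - C ·)).prod * u ∣ v ^ 2 - quintic) :
    mumfordClass ((l.map (X - C ·)).prod * u) v =
      (l.map fun a => pointClass a (v.eval a)).prod * mumfordClass u v := by
  induction l with
  | nil => simp
  | cons a l ih =>
    simp only [List.map_cons, List.prod_cons, mul_assoc] at h ⊢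
    rw [mumfordClass_mul h, ih ((dvd_mul_left _ _).trans h), mumfordClass_X_sub_C]

lemma prod_pointClass_mul_eq_one (l : List (ZMod 5)) (u v : (ZMod 5)[X])
    (h : v ^ 2 - quintic = -((l.map (X - C ·)).prod * u)) :
    (l.map fun a => pointClass a (v.eval a)).prod * mumfordClass u v = 1 := by
  have h' : (l.map (X - C ·)).prod * u ∣ v ^ 2 - quintic := ⟨-1, by rw [h]; ring⟩
  rw [← mumfordClass_prod_X_sub_C_mul l u v h']
  simpa [mumfordClass_of_isUnit isUnit_one] using
    mumfordClass_mul_eq_one (u₁ := (l.map (X - C ·)).prod * u) (u₂ := 1) (v := v) (by rw [h, mul_one])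

lemma pointClass_mul_neg {a b : ZMod 5} (h : b ^ 2 = quintic.eval a) :
    pointClass a b * pointClass a (-b) = 1 := by
  rw [pointClass, pointClass, C_neg]
  refine mumfordClass_mul_neg (dvd_iff_isRoot.2 ?_)
  simp [h]

lemma prod_pointClass_eq_one (l : List (ZMod 5)) (v : (ZMod 5)[X])
    (h : v ^ 2 - quintic = -(l.map (X - C ·)).prod) :
    (l.map fun a => pointClass a (v.eval a)).prod = 1 := by
  simpa [mumfordClass_of_isUnit isUnit_one] using
    prod_pointClass_mul_eq_one l 1 v (by rw [h, mul_one])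

lemma pointClass_relation_one :
    pointClass 1 4 * pointClass 2 1 ^ 3 * pointClass 3 3 = 1 := by
  have h := prod_pointClass_eq_one [1, 2, 2, 2, 3] (2 * X + 2) (by
    simp only [quintic, List.map_cons, List.map_nil, List.prod_cons, List.prod_nil, map_ofNat,
      map_one]
    rw [← sub_eq_zero]
    ring_nf
    reduce_mod_char)
  have e₁ : (2 + 2 : ZMod 5) = 4 := by decide
  have e₂ : (2 * 2 + 2 : ZMod 5) = 1 := by decide
  have e₃ : (2 * 3 + 2 : ZMod 5) = 3 := by decide
  simp [e₁, e₂, e₃] at h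
  simpa [pow_succ, mul_assoc] using h

lemma pointClass_relation_two :
    pointClass 2 4 * pointClass 3 3 ^ 3 * pointClass 4 2 = 1 := by
  have h := prod_pointClass_eq_one [2, 3, 3, 3, 4] (4 * X + 1) (by
    simp only [quintic, List.map_cons, List.map_nil, List.prod_cons, List.prod_nil, map_ofNat]
    rw [← sub_eq_zero]
    ring_nf
    reduce_mod_char)
  have e₁ : (4 * 2 + 1 : ZMod 5) = 4 := by decide
  have e₂ : (4 * 3 + 1 : ZMod 5) = 3 := by decide
  have e₃ : (4 * 4 + 1 : ZMod 5) = 2 := by decide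
  simp [e₁, e₂, e₃] at h
  simpa [pow_succ, mul_assoc] using h

lemma pointClass_relation_three : pointClass 1 1 ^ 4 * pointClass 0 0 = 1 := by
  have h := prod_pointClass_eq_one [1, 1, 1, 1, 0] (3 * X ^ 2 + 3 * X) (by
    simp only [quintic, List.map_cons, List.map_nil, List.prod_cons, List.prod_nil, map_one,
      map_zero]
    rw [← sub_eq_zero]
    ring_nf
    reduce_mod_char)
  have e₁ : (3 + 3 : ZMod 5) = 1 := by decide
  simp [e₁] at h
  simpa [pow_succ, mul_assoc] using h

lemma pointClass_relation_four :
    pointClass 2 1 ^ 4 * mumfordClass (X ^ 2 + 2 * X + 4) 0 = 1 := by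
  have h := prod_pointClass_mul_eq_one [2, 2, 2, 2] (X ^ 2 + 2 * X + 4)
    (0 + (X ^ 2 + 2 * X + 4) * (2 * X + 4))
    (by
      simp only [quintic, List.map_cons, List.map_nil, List.prod_cons, List.prod_nil, map_ofNat]
      rw [← sub_eq_zero]
      ring_nf
      reduce_mod_char)
  rw [mumfordClass_add_mul] at h
  have e₁ : ((2 ^ 2 + 2 * 2 + 4) * (2 * 2 + 4) : ZMod 5) = 1 := by decide
  simp [e₁] at h
  simpa [pow_succ, mul_assoc] using h

/-- The subgroup generated by the classes of the points `(1, 1)` and `(2, 1)`. -/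
def pointSubgroup : Subgroup (ClassGroup R5) :=
  Subgroup.closure {pointClass 1 1, pointClass 2 1}

lemma pointClass_one_one_mem : pointClass 1 1 ∈ pointSubgroup :=
  Subgroup.subset_closure (by simp)

lemma pointClass_two_one_mem : pointClass 2 1 ∈ pointSubgroup :=
  Subgroup.subset_closure (by simp)

lemma pointClass_neg_mem {a b b' : ZMod 5} (hb : b' = -b) (h : b ^ 2 = a ^ 5 - a ^ 3 + a)
    (hab : pointClass a b ∈ pointSubgroup) : pointClass a b' ∈ pointSubgroup := by
  rw [hb, eq_inv_of_mul_eq_one_right (pointClass_mul_neg (h.trans (eval_quintic a).symm))]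
  exact inv_mem hab

lemma pointClass_mem {a b : ZMod 5} (h : b ^ 2 = a ^ 5 - a ^ 3 + a) :
    pointClass a b ∈ pointSubgroup := by
  have h₁₄ : pointClass 1 4 ∈ pointSubgroup :=
    pointClass_neg_mem (by decide) (by decide) pointClass_one_one_mem
  have h₂₄ : pointClass 2 4 ∈ pointSubgroup :=
    pointClass_neg_mem (by decide) (by decide) pointClass_two_one_mem
  have h₃₃ : pointClass 3 3 ∈ pointSubgroup := by
    rw [eq_inv_of_mul_eq_one_right pointClass_relation_one]
    exact inv_mem (mul_mem h₁₄ (pow_mem pointClass_two_one_mem 3))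
  have h₄₂ : pointClass 4 2 ∈ pointSubgroup := by
    rw [eq_inv_of_mul_eq_one_right pointClass_relation_two]
    exact inv_mem (mul_mem h₂₄ (pow_mem h₃₃ 3))
  have h₀₀ : pointClass 0 0 ∈ pointSubgroup := by
    rw [eq_inv_of_mul_eq_one_right pointClass_relation_three]
    exact inv_mem (pow_mem pointClass_one_one_mem 4)
  have key : ∀ a b : ZMod 5, b ^ 2 = a ^ 5 - a ^ 3 + a →
      (a, b) ∈ [((0, 0) : ZMod 5 × ZMod 5), (1, 1), (2, 1), (3, 3), (4, 2)] ∨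
      (a, -b) ∈ [((1, 1) : ZMod 5 × ZMod 5), (2, 1), (3, 3), (4, 2)] := by decide
  have hpos : ∀ {a b : ZMod 5},
      (a, b) ∈ [((0, 0) : ZMod 5 × ZMod 5), (1, 1), (2, 1), (3, 3), (4, 2)] →
      pointClass a b ∈ pointSubgroup := by
    intro a b hab
    simp only [List.mem_cons, Prod.mk.injEq, List.not_mem_nil, or_false] at hab
    rcases hab with ⟨rfl, rfl⟩ | ⟨rfl, rfl⟩ | ⟨rfl, rfl⟩ | ⟨rfl, rfl⟩ | ⟨rfl, rfl⟩
    exacts [h₀₀, pointClass_one_one_mem, pointClass_two_one_mem, h₃₃, h₄₂]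
  rcases key a b h with hab | hab
  · exact hpos hab
  · exact pointClass_neg_mem (neg_neg b).symm (by rw [neg_sq, h]) (hpos (List.mem_cons_of_mem _ hab))

lemma mumfordClass_X_sub_C_mem {a : ZMod 5} {v : (ZMod 5)[X]} (h : X - C a ∣ v ^ 2 - quintic) :
    mumfordClass (X - C a) v ∈ pointSubgroup := by
  rw [mumfordClass_X_sub_C]
  refine pointClass_mem ?_
  have := dvd_iff_isRoot.1 h
  rw [IsRoot, eval_sub, eval_pow, eval_quintic] at this
  exact sub_eq_zero.1 this

lemma mumfordClass_mem_of_natDegree_eq_two {p q r s : ZMod 5}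
    (h : X ^ 2 + C p * X + C q ∣ (C r * X + C s) ^ 2 - quintic) :
    mumfordClass (X ^ 2 + C p * X + C q) (C r * X + C s) ∈ pointSubgroup := by
  have hrem : C (2 * r * s - r ^ 2 * p - (p ^ 4 - 3 * p ^ 2 * q + q ^ 2) + (p ^ 2 - q) - 1) * X +
      C (s ^ 2 - r ^ 2 * q - (p ^ 3 * q - 2 * p * q ^ 2) + p * q) = 0 := by
    have hdvd : X ^ 2 + C p * X + C q ∣
        C (2 * r * s - r ^ 2 * p - (p ^ 4 - 3 * p ^ 2 * q + q ^ 2) + (p ^ 2 - q) - 1) * X +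
        C (s ^ 2 - r ^ 2 * q - (p ^ 3 * q - 2 * p * q ^ 2) + p * q) := by
      obtain ⟨k, hk⟩ := h
      refine ⟨k - (C (r ^ 2 - (2 * p * q - p ^ 3) - p) - C (p ^ 2 - q) * X + X * C p * X - X ^ 3 + X), ?_⟩
      rw [mul_sub, ← hk, quintic]
      simp only [C_sub, C_add, C_mul, C_pow, C_1, C_ofNat]
      ring
    refine eq_zero_of_dvd_of_natDegree_lt hdvd (natDegree_linear_le.trans_lt ?_)
    have : (X ^ 2 + C p * X + C q).natDegree = 2 := by compute_degree!
    rw [this]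
    exact one_lt_two
  have h₁ := congrArg (coeff · 1) hrem
  have h₂ := congrArg (coeff · 0) hrem
  simp only [coeff_add, coeff_C_mul, coeff_X_one, coeff_X_zero, coeff_C_zero, mul_one, mul_zero,
    zero_add, add_zero, coeff_zero, coeff_C_of_ne_zero one_ne_zero] at h₁ h₂
  rcases exists_splitting p q r s h₁ h₂ with ⟨e, he⟩ | ⟨c, a, b, d, e₁, e₂, e₃, e₄, e₅⟩
  · have hu : X ^ 2 + C p * X + C q = (X - C e) * (X - C (-e - p)) := by
      have := congrArg C he
      simp only [C_sub, C_add, C_mul, C_pow, C_neg, C_0] at this ⊢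
      linear_combination this
    rw [hu] at h ⊢
    rw [mumfordClass_mul h]
    exact mul_mem (mumfordClass_X_sub_C_mem ((dvd_mul_right _ _).trans h))
      (mumfordClass_X_sub_C_mem ((dvd_mul_left _ _).trans h))
  · have hw : (C r * X + C s + (X ^ 2 + C p * X + C q) * C c) ^ 2 - quintic =
        -(([a, b, d].map (X - C ·)).prod * (X ^ 2 + C p * X + C q)) := by
      have e₁ := congrArg C e₁
      have e₂ := congrArg C e₂
      have e₃ := congrArg C e₃
      have e₄ := congrArg C e₄
      have e₅ := congrArg C e₅
      simp only [List.map_cons, List.map_nil, List.prod_cons, List.prod_nil, quintic, C_sub,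
        C_add, C_mul, C_pow, C_neg, C_1, C_ofNat] at e₁ e₂ e₃ e₄ e₅ ⊢
      linear_combination X ^ 4 * e₁ + X ^ 3 * e₂ + X ^ 2 * e₃ + X * e₄ + e₅
    have hdvd : ([a, b, d].map (X - C ·)).prod ∣
        (C r * X + C s + (X ^ 2 + C p * X + C q) * C c) ^ 2 - quintic := by
      rw [hw]
      exact (dvd_mul_right _ _).neg_right
    have hw := prod_pointClass_mul_eq_one _ _ _ hw
    rw [mumfordClass_add_mul] at hw
    rw [eq_inv_of_mul_eq_one_right hw]
    refine inv_mem (list_prod_mem fun x hx => ?_)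
    obtain ⟨t, ht, rfl⟩ := List.mem_map.1 hx
    rw [← mumfordClass_X_sub_C]
    refine mumfordClass_X_sub_C_mem ((List.dvd_prod ?_).trans hdvd)
    exact List.mem_map_of_mem ht

lemma mumfordClass_mem {u v : (ZMod 5)[X]} (h : u ∣ v ^ 2 - quintic) :
    mumfordClass u v ∈ pointSubgroup := by
  induction hn : u.natDegree using Nat.strong_induction_on generalizing u v with
  | _ n ih =>
  have hu : u ≠ 0 := by
    rintro rfl
    exact sq_ne_quintic v (sub_eq_zero.1 (zero_dvd_iff.1 h))
  have hlc : IsUnit (C u.leadingCoeff⁻¹) :=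
    isUnit_C.2 (inv_ne_zero (leadingCoeff_ne_zero.2 hu)).isUnit
  have hdvd : u * C u.leadingCoeff⁻¹ ∣ v ^ 2 - quintic := hlc.mul_right_dvd.2 h
  have hclass : mumfordClass u v = mumfordClass (u * C u.leadingCoeff⁻¹) v := by
    rw [mumfordClass_mul hdvd, mumfordClass_of_isUnit hlc, mul_one]
  have hmonic := monic_mul_leadingCoeff_inv hu
  have hdeg : (u * C u.leadingCoeff⁻¹).natDegree = n := by
    rw [natDegree_mul_leadingCoeff_inv _ hu, hn]
  rw [hclass]
  generalize u * C u.leadingCoeff⁻¹ = m at hdvd hmonic hdeg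
  have hv : v % m + m * (v / m) = v := EuclideanDomain.mod_add_div v m
  have hmod : m ∣ (v % m) ^ 2 - quintic := by
    rw [← hv] at hdvd
    refine (dvd_add_right (dvd_mul_right m ((v / m) * (2 * (v % m) + m * (v / m))))).1 ?_
    convert hdvd using 1
    ring
  rw [← hv, mumfordClass_add_mul]
  have hlt : n ≠ 0 → (v % m).natDegree < n := fun h0 => by
    rw [← hdeg]
    exact natDegree_mod_lt v (hdeg ▸ h0)
  generalize v % m = w at hmod hlt
  rcases (by omega : n = 0 ∨ n = 1 ∨ n = 2 ∨ 3 ≤ n) with rfl | rfl | rfl | h3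
  · rw [hmonic.natDegree_eq_zero.1 hdeg, mumfordClass_of_isUnit isUnit_one]
    exact one_mem _
  · have hm : m = X - C (-m.coeff 0) := by
      rw [C_neg, sub_neg_eq_add]
      exact hmonic.eq_X_add_C hdeg
    rw [hm] at hmod ⊢
    exact mumfordClass_X_sub_C_mem hmod
  · obtain ⟨r, s, rfl⟩ := exists_eq_X_add_C_of_natDegree_le_one
      (Nat.le_of_lt_succ (hlt two_ne_zero))
    have hm : m = X ^ 2 + C (m.coeff 1) * X + C (m.coeff 0) := by
      conv_lhs => rw [hmonic.as_sum, hdeg]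
      simp [Finset.sum_range_succ]
      ring
    rw [hm] at hmod ⊢
    exact mumfordClass_mem_of_natDegree_eq_two hmod
  · obtain ⟨k, hk⟩ := hmod
    have hk0 : k ≠ 0 := by
      rintro rfl
      exact sq_ne_quintic w (sub_eq_zero.1 (hk.trans (mul_zero m)))
    have hle := natDegree_sub_le (w ^ 2) quintic
    rw [hk, natDegree_mul hmonic.ne_zero hk0, natDegree_pow, natDegree_quintic, hdeg] at hle
    have hmul := @mumfordClass_mul_eq_one _ m (-k) w (by rw [hk, mul_neg, neg_neg])
    rw [eq_inv_of_mul_eq_one_left hmul]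
    refine inv_mem (ih _ ?_ ⟨-m, by rw [hk]; ring⟩ (natDegree_neg k))
    have := hlt (by omega)
    omega

lemma pointSubgroup_eq_top : pointSubgroup = ⊤ := by
  refine (Subgroup.eq_top_iff' _).2 fun x => ?_
  obtain ⟨⟨I, hI⟩, rfl⟩ := ClassGroup.mk0_surjective x
  obtain ⟨g, u, v, hg, hu, huv, rfl⟩ :=
    exists_eq_span_mul_mumford (mem_nonZeroDivisors_iff_ne_zero.1 hI)
  have : ClassGroup.mk0 ⟨_, hI⟩ = mumfordClass u v := by
    rw [mumfordClass, ClassGroup.mk0_eq_mk0_iff]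
    refine ⟨1, base g, one_ne_zero, (map_ne_zero_iff _ base_injective).2 hg, ?_⟩
    rw [Ideal.span_singleton_one, Ideal.top_mul]
  rw [this]
  exact mumfordClass_mem huv

lemma isUnit_of_mumfordClass_zero_eq_one {u : (ZMod 5)[X]} (hu : u ∣ quintic)
    (hdeg : u.natDegree ≤ 2) (h : mumfordClass u 0 = 1) : IsUnit u := by
  obtain ⟨α, hα⟩ := mumfordClass_eq_one_iff.1 h
  have hdvd : ∀ z ∈ mumford u 0, α ∣ z := fun z hz => Ideal.mem_span_singleton.1 (hα.le hz)
  have hαmem : α ∈ mumford u 0 := hα.ge (Ideal.mem_span_singleton_self α)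
  obtain ⟨c, d, rfl⟩ := exists_eq_base_add α
  obtain ⟨β, hβ⟩ := hdvd (base u) (Ideal.subset_span (by simp))
  obtain ⟨γ, hγ⟩ := hdvd y5 (Ideal.subset_span (by simp))
  obtain ⟨e, g, rfl⟩ := exists_eq_base_add β
  obtain ⟨e', g', rfl⟩ := exists_eq_base_add γ
  rw [base_add_mul] at hβ hγ
  obtain ⟨hβ₀, hβ₁⟩ := base_add_inj (c := u) (d := 0) (Eq.trans (by simp) hβ)
  obtain ⟨hγ₀, hγ₁⟩ := base_add_inj (c := 0) (d := 1) (Eq.trans (by simp) hγ)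
  have hnorm : (c ^ 2 - d ^ 2 * quintic) * (e ^ 2 - g ^ 2 * quintic) = u ^ 2 := by
    rw [hβ₀]
    linear_combination quintic * (c * g + d * e) * hβ₁
  have hnorm' : (c ^ 2 - d ^ 2 * quintic) * (-(e' ^ 2 - g' ^ 2 * quintic)) = quintic := by
    linear_combination (c * e' + d * g' * quintic) * hγ₀ -
      quintic * (c * g' + d * e' + 1) * hγ₁
  have hu0 : u ≠ 0 := by
    rintro rfl
    simpa [zero_dvd_iff.1 hu] using natDegree_quintic
  have hd : d = 0 := by
    refine eq_zero_of_natDegree_sub_lt (c := c) (lt_of_le_of_lt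
      (natDegree_le_of_dvd ⟨_, hnorm.symm⟩ (pow_ne_zero 2 hu0)) ?_)
    rw [natDegree_pow]
    omega
  subst hd
  have hc : IsUnit c := isUnit_of_sq_dvd_quintic ⟨_, by simpa using hnorm'.symm⟩
  refine isUnit_of_dvd_unit ?_ hc
  simpa using base_add_mem_mumford (by simpa using hu) hαmem

lemma mumfordClass_zero_ne_one {u : (ZMod 5)[X]} (hu : u ∣ quintic) (h₀ : 0 < u.natDegree)
    (h₂ : u.natDegree ≤ 2) : mumfordClass u 0 ≠ 1 := fun h =>
  h₀.ne' (natDegree_eq_zero_of_isUnit (isUnit_of_mumfordClass_zero_eq_one hu h₂ h))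

lemma mumfordClass_zero_mul_self {u : (ZMod 5)[X]} (hu : u ∣ quintic) :
    mumfordClass u 0 * mumfordClass u 0 = 1 := by
  simpa using mumfordClass_mul_neg (u := u) (v := 0) (by simpa using hu)

lemma nonempty_classGroup_mulEquiv :
    Nonempty (ClassGroup R5 ≃* Multiplicative (ZMod 8 × ZMod 8)) := by
  have hX : (X : (ZMod 5)[X]) ∣ quintic :=
    ⟨(X ^ 2 + 2 * X + 4) * (X ^ 2 + 3 * X + 4), by rw [quintic_eq_mul]; ring⟩
  have hq : (X ^ 2 + 2 * X + 4 : (ZMod 5)[X]) ∣ quintic :=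
    ⟨X * (X ^ 2 + 3 * X + 4), by rw [quintic_eq_mul]; ring⟩
  have hq' : (X ^ 2 + 3 * X + 4 : (ZMod 5)[X]) ∣ quintic :=
    ⟨X * (X ^ 2 + 2 * X + 4), by rw [quintic_eq_mul]; ring⟩
  have hdeg : (X ^ 2 + 2 * X + 4 : (ZMod 5)[X]).natDegree = 2 := by
    simpa only [C_ofNat] using natDegree_quadratic 2 4
  have hdeg' : (X ^ 2 + 3 * X + 4 : (ZMod 5)[X]).natDegree = 2 := by
    simpa only [C_ofNat] using natDegree_quadratic 3 4
  have hXne := mumfordClass_zero_ne_one hX (by simp) (by simp)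
  have hqne := mumfordClass_zero_ne_one hq (by simp [hdeg]) hdeg.le
  have hqne' := mumfordClass_zero_ne_one hq' (by simp [hdeg']) hdeg'.le
  have hXq : mumfordClass (X * (X ^ 2 + 2 * X + 4)) 0 =
      mumfordClass X 0 * mumfordClass (X ^ 2 + 2 * X + 4) 0 :=
    mumfordClass_mul ⟨-(X ^ 2 + 3 * X + 4), by rw [quintic_eq_mul]; ring⟩
  have hprod := mumfordClass_mul_eq_one (u₁ := X * (X ^ 2 + 2 * X + 4)) (u₂ := X ^ 2 + 3 * X + 4)
    (v := 0) (by rw [quintic_eq_mul]; ring)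
  have ha := pointClass_relation_three
  have hpoint : pointClass 0 0 = mumfordClass X 0 := by rw [pointClass, C_0, sub_zero]
  rw [hpoint] at ha
  have hb := pointClass_relation_four
  replace ha := (eq_inv_of_mul_eq_one_left ha).trans
    (eq_inv_of_mul_eq_one_left (mumfordClass_zero_mul_self hX)).symm
  replace hb := (eq_inv_of_mul_eq_one_left hb).trans
    (eq_inv_of_mul_eq_one_left (mumfordClass_zero_mul_self hq)).symm
  refine nonempty_mulEquiv_zmod_eight (a := pointClass 1 1) (b := pointClass 2 1)
    ?_ ?_ (ha ▸ hXne) (hb ▸ hqne) ?_ pointSubgroup_eq_top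
  · rw [pow_mul _ 4 2, ha, sq, mumfordClass_zero_mul_self hX]
  · rw [pow_mul _ 4 2, hb, sq, mumfordClass_zero_mul_self hq]
  · rw [ha, hb, ← hXq]
    intro h
    rw [h, one_mul] at hprod
    exact hqne' hprod

end ClassGroup

end R5

/-- The ideal class group of `R₅` is isomorphic to `ℤ/8ℤ × ℤ/8ℤ`; in particular it has
cardinality 64.  (The hypothesis `IsDomain R5` is a true fact, supplied so that
`ClassGroup R5` makes sense.) -/
theorem stmt_11 [IsDomain R5] :
    Nonempty (ClassGroup R5 ≃* Multiplicative (ZMod 8 × ZMod 8)) ∧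
    Nat.card (ClassGroup R5) = 64 := by
  obtain ⟨e⟩ := R5.nonempty_classGroup_mulEquiv
  refine ⟨⟨e⟩, ?_⟩
  rw [Nat.card_congr e.toEquiv, Nat.card_congr Multiplicative.toAdd, Nat.card_prod, Nat.card_zmod]
end
end
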